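/- arXiv:0704.2824 — 2 statements merged into one kernel-verified Lean document; each statement's English description precedes it below -/
import Mathlib

section
/- Let f be a polynomial in ℚ[x₁,…,xₙ] and let v be a column vector of monomials. If there exists a real symmetric positive semidefinite matrix B that is invertible (hence positive definite) with f = vᵀBv, then there exists a rational symmetric positive semidefinite matrix B' of the same size with f = vᵀB'v. -/
/-- Symmetrize `X` and correct it so that the sums over fibres of `d i + d j` match `c`. -/
noncomputable def gramFix {n k : ℕ} {K : Type*} [Field K] (d : Fin k → (Fin n →₀ ℕ))
    (c : (Fin n →₀ ℕ) → K) (X : Fin k → Fin k → K) : Matrix (Fin k) (Fin k) K :=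
  fun i j => (X i j + X j i) / 2 +
    (c (d i + d j) - ∑ p : Fin k × Fin k, if d p.1 + d p.2 = d i + d j then X p.1 p.2 else 0) /
      (∑ p : Fin k × Fin k, if d p.1 + d p.2 = d i + d j then (1 : K) else 0)

theorem gram_coeff {n k : ℕ} {K : Type*} [Field K] (d : Fin k → (Fin n →₀ ℕ))
    (X : Matrix (Fin k) (Fin k) K) (m : Fin n →₀ ℕ) :
    MvPolynomial.coeff m (∑ i, ∑ j, MvPolynomial.C (X i j) *
        (MvPolynomial.monomial (d i) (1 : K) * MvPolynomial.monomial (d j) (1 : K))) =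
      ∑ p : Fin k × Fin k, if d p.1 + d p.2 = m then X p.1 p.2 else 0 := by
  rw [Fintype.sum_prod_type]
  simp [MvPolynomial.coeff_sum, MvPolynomial.monomial_mul, MvPolynomial.coeff_C_mul,
    MvPolynomial.coeff_monomial]

theorem gramFix_sum {n k : ℕ} {K : Type*} [Field K] [CharZero K] (d : Fin k → (Fin n →₀ ℕ))
    (c : (Fin n →₀ ℕ) → K) (X : Fin k → Fin k → K) (m : Fin n →₀ ℕ)
    (hm : (∀ i j, d i + d j ≠ m) → c m = 0) :
    (∑ p : Fin k × Fin k, if d p.1 + d p.2 = m then gramFix d c X p.1 p.2 else 0) = c m := by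
  by_cases h : ∀ i j, d i + d j ≠ m
  · rw [hm h]
    exact Finset.sum_eq_zero fun p _ => if_neg (h _ _)
  push Not at h
  obtain ⟨i₀, j₀, h0⟩ := h
  set S : K := ∑ p : Fin k × Fin k, if d p.1 + d p.2 = m then X p.1 p.2 else 0 with hS
  set N : K := ∑ p : Fin k × Fin k, if d p.1 + d p.2 = m then (1 : K) else 0 with hN
  have hN0 : N ≠ 0 := by
    rw [hN, Finset.sum_boole]
    have : 0 < (Finset.univ.filter fun p : Fin k × Fin k => d p.1 + d p.2 = m).card :=
      Finset.card_pos.2 ⟨(i₀, j₀), by simp [h0]⟩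
    exact_mod_cast this.ne'
  have hT : (∑ p : Fin k × Fin k, if d p.1 + d p.2 = m then X p.2 p.1 else 0) = S := by
    rw [hS]
    refine Fintype.sum_equiv (Equiv.prodComm _ _) _ _ fun p => ?_
    simp [add_comm]
  have : ∀ p : Fin k × Fin k, (if d p.1 + d p.2 = m then gramFix d c X p.1 p.2 else 0) =
      ((if d p.1 + d p.2 = m then X p.1 p.2 else 0) +
        (if d p.1 + d p.2 = m then X p.2 p.1 else 0)) / 2 +
      (if d p.1 + d p.2 = m then (1 : K) else 0) * ((c m - S) / N) := by
    intro p
    split_ifs with hp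
    · simp only [gramFix, hp, hS, hN, one_mul]
    · simp
  rw [Finset.sum_congr rfl fun p _ => this p, Finset.sum_add_distrib, ← Finset.sum_div,
    Finset.sum_add_distrib, ← Finset.sum_mul, hT, ← hS, ← hN]
  field_simp
  ring

theorem gramFix_symm {n k : ℕ} {K : Type*} [Field K] (d : Fin k → (Fin n →₀ ℕ))
    (c : (Fin n →₀ ℕ) → K) (X : Fin k → Fin k → K) : (gramFix d c X).IsSymm := by
  ext i j
  simp only [Matrix.transpose_apply, gramFix, add_comm (d j) (d i), add_comm (X j i)]

theorem gramFix_map {n k : ℕ} (d : Fin k → (Fin n →₀ ℕ))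
    (c : (Fin n →₀ ℕ) → ℚ) (X : Fin k → Fin k → ℚ) (i j : Fin k) :
    gramFix d (fun m => (c m : ℝ)) (fun i j => (X i j : ℝ)) i j =
      ((gramFix d c X i j : ℚ) : ℝ) := by
  simp only [gramFix]
  push_cast [apply_ite (Rat.cast : ℚ → ℝ)]
  rfl

theorem gramFix_cont {n k : ℕ} (d : Fin k → (Fin n →₀ ℕ)) (c : (Fin n →₀ ℕ) → ℝ) (i j : Fin k) :
    Continuous fun X : Fin k → Fin k → ℝ => gramFix d c X i j := by
  unfold gramFix
  refine Continuous.add (by fun_prop) (Continuous.div_const ?_ _)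
  refine continuous_const.sub (continuous_finsetSum _ fun p _ => ?_)
  split_ifs <;> fun_prop

/-- If a polynomial `f ∈ ℚ[x₁,…,xₙ]` has an invertible real positive semidefinite
Gram matrix `B` with respect to a vector of monomials, then it has a rational
positive semidefinite Gram matrix of the same size with respect to the same
vector of monomials. -/
theorem stmt_0 (n k : ℕ) (f : MvPolynomial (Fin n) ℚ)
    (d : Fin k → (Fin n →₀ ℕ)) (B : Matrix (Fin k) (Fin k) ℝ)
    (hBsym : B.IsSymm) (hBpsd : B.PosSemidef) (hBinv : IsUnit B.det)
    (hf : MvPolynomial.map (algebraMap ℚ ℝ) f =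
      ∑ i, ∑ j, MvPolynomial.C (B i j) *
        (MvPolynomial.monomial (d i) (1 : ℝ) * MvPolynomial.monomial (d j) (1 : ℝ))) :
    ∃ B' : Matrix (Fin k) (Fin k) ℚ, B'.IsSymm ∧ B'.PosSemidef ∧
      f = ∑ i, ∑ j, MvPolynomial.C (B' i j) *
        (MvPolynomial.monomial (d i) (1 : ℚ) * MvPolynomial.monomial (d j) (1 : ℚ)) := by
  have hpd : B.PosDef := by
    rw [hBpsd.posDef_iff_isUnit]
    exact (Matrix.isUnit_iff_isUnit_det B).2 hBinv
  have hc : ∀ m, ((MvPolynomial.coeff m f : ℚ) : ℝ) =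
      ∑ p : Fin k × Fin k, if d p.1 + d p.2 = m then B p.1 p.2 else 0 := by
    intro m
    rw [← gram_coeff, ← hf, MvPolynomial.coeff_map]
    rfl
  set c : (Fin n →₀ ℕ) → ℚ := fun m => MvPolynomial.coeff m f with hcdef
  set Q : (Fin k → Fin k → ℝ) → (Fin k → ℝ) → ℝ := fun X x =>
    ∑ i, ∑ j, x i * gramFix d (fun m => (c m : ℝ)) X i j * x j with hQ
  have hfixB : gramFix d (fun m => (c m : ℝ)) B = B := by
    ext i j
    have : B j i = B i j := hBsym.apply i j
    simp only [gramFix, hcdef, hc, sub_self, zero_div, this]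
    ring
  have hQB : ∀ x : Fin k → ℝ, x ≠ 0 → 0 < Q B x := by
    intro x hx
    have := hpd.dotProduct_mulVec_pos hx
    simp only [hQ, hfixB]
    simpa [dotProduct, Matrix.mulVec, Finset.mul_sum, mul_assoc] using this
  have hQc : Continuous fun q : (Fin k → Fin k → ℝ) × (Fin k → ℝ) => Q q.1 q.2 := by
    simp only [hQ]
    refine continuous_finsetSum _ fun i _ => continuous_finsetSum _ fun j _ => ?_
    have := (gramFix_cont d (fun m => (c m : ℝ)) i j).comp
      (continuous_fst : Continuous fun q : (Fin k → Fin k → ℝ) × (Fin k → ℝ) => q.1)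
    have h2 : Continuous fun q : (Fin k → Fin k → ℝ) × (Fin k → ℝ) => q.2 i := by fun_prop
    have h3 : Continuous fun q : (Fin k → Fin k → ℝ) × (Fin k → ℝ) => q.2 j := by fun_prop
    exact (h2.mul this).mul h3
  have hev : ∀ᶠ X in nhds (B : Fin k → Fin k → ℝ),
      ∀ x ∈ Metric.sphere (0 : Fin k → ℝ) 1, 0 < Q X x := by
    refine (isCompact_sphere _ _).eventually_forall_of_forall_eventually fun x hx => ?_
    refine (hQc.tendsto (B, x)).eventually (lt_mem_nhds (hQB x ?_))
    rintro rfl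
    simp at hx
  have hdense : DenseRange fun (X : Fin k → Fin k → ℚ) i j => ((X i j : ℚ) : ℝ) := 
    DenseRange.piMap fun _ => DenseRange.piMap fun _ => Rat.denseRange_cast
  obtain ⟨X, hX⟩ := hdense.exists_mem_open isOpen_interior ⟨_, mem_interior_iff_mem_nhds.2 hev⟩
  replace hX := interior_subset hX
  simp only [Set.mem_ofPred_eq] at hX
  have hnn : ∀ x : Fin k → ℝ, 0 ≤ Q (fun i j => ((X i j : ℚ) : ℝ)) x := by
    intro x
    by_cases hx : x = 0
    · simp [hQ, hx]
    have hn : 0 < ‖x‖ := norm_pos_iff.2 hx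
    have h1 := hX (‖x‖⁻¹ • x) (by simp [norm_smul, hn.ne'])
    have h2 : Q (fun i j => ((X i j : ℚ) : ℝ)) (‖x‖⁻¹ • x) =
        (‖x‖⁻¹) ^ 2 * Q (fun i j => ((X i j : ℚ) : ℝ)) x := by
      simp only [hQ, Finset.mul_sum, Pi.smul_apply, smul_eq_mul]
      refine Finset.sum_congr rfl fun i _ => Finset.sum_congr rfl fun j _ => ?_
      ring
    rw [h2] at h1
    exact (pos_of_mul_pos_right h1 (by positivity)).le
  refine ⟨gramFix d c X, gramFix_symm d c X, ?_, ?_⟩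
  · refine Matrix.PosSemidef.of_dotProduct_mulVec_nonneg ?_ fun x => ?_
    · ext i j
      simpa using (gramFix_symm d c X).apply i j
    · have := hnn fun i => (x i : ℝ)
      simp only [hQ, gramFix_map] at this
      have h3 : (0 : ℚ) ≤ ∑ i, ∑ j, x i * gramFix d c X i j * x j := by exact_mod_cast this
      simpa [dotProduct, Matrix.mulVec, Finset.mul_sum, mul_assoc] using h3
  · ext m
    rw [gram_coeff, gramFix_sum]
    intro h
    have := hc m
    rw [Finset.sum_eq_zero fun p _ => if_neg (h _ _)] at this
    exact_mod_cast this
end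

section
/- Let b₁,…,b_r, δ, and d₁,…,d_r be complex numbers, let B = diag(b₁,…,b_r), let d = [d₁,…,d_r]ᵀ, and set A = B − δ·d·dᵀ. Then the characteristic polynomial of A satisfies det(xI − A) = Π_{k=1}^r (x − b_k) + δ·Σ_{k=1}^r d_k² · Π_{i=1, i≠k}^r (x − b_i). -/
open Polynomial

lemma det_diag_add_rank_one {K : Type*} [Field K] {r : ℕ} (a u v : Fin r → K)
    (ha : ∀ i, a i ≠ 0) :
    (Matrix.diagonal a + Matrix.of fun i j => u i * v j).det =
      ∏ k, a k + ∑ k, u k * v k * ∏ i ∈ Finset.univ.erase k, a i := by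
  have h1 : (Matrix.diagonal a + Matrix.of fun i j => u i * v j) =
      Matrix.diagonal a * (1 + Matrix.replicateCol Unit (fun i => (a i)⁻¹ * u i) *
        Matrix.replicateRow Unit v) := by
    rw [mul_add, mul_one]
    congr 1
    ext i j
    rw [Matrix.diagonal_mul]
    simp [Matrix.mul_apply, ← mul_assoc, ha i]
  rw [h1, Matrix.det_mul, Matrix.det_one_add_replicateCol_mul_replicateRow, Matrix.det_diagonal,
    mul_add, mul_one, dotProduct, Finset.mul_sum]
  congr 1
  refine Finset.sum_congr rfl fun k _ => ?_
  rw [← Finset.mul_prod_erase Finset.univ a (Finset.mem_univ k)]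
  have := ha k
  field_simp

/-- Sherman–Morrison-type determinant identity: for complex numbers `b₁,…,b_r`, `δ`,
`d₁,…,d_r`, the matrix `A = diag(b₁,…,b_r) − δ·d·dᵀ` satisfies
`det(xI − A) = Π_k (x − b_k) + δ·Σ_k d_k²·Π_{i≠k} (x − b_i)`. -/
theorem stmt_9 (r : ℕ) (b d : Fin r → ℂ) (δ : ℂ) :
    (Matrix.diagonal b - δ • Matrix.of fun i j => d i * d j).charpoly =
      ∏ k, (X - C (b k)) +
        C δ * ∑ k, C (d k ^ 2) * ∏ i ∈ Finset.univ.erase k, (X - C (b i)) := by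
  have hinj := IsFractionRing.injective ℂ[X] (FractionRing ℂ[X])
  set f := algebraMap ℂ[X] (FractionRing ℂ[X])
  apply hinj
  have key := det_diag_add_rank_one (fun i => f (X - C (b i))) (fun i => f (C δ * C (d i)))
    (fun i => f (C (d i))) (fun i h => X_sub_C_ne_zero (b i) (hinj (by rw [h, map_zero])))
  rw [Matrix.charpoly, RingHom.map_det]
  refine Eq.trans (congrArg Matrix.det ?_) (key.trans ?_)
  · ext i j
    simp only [RingHom.mapMatrix_apply, Matrix.map_apply, Matrix.add_apply, Matrix.of_apply]
    rw [← map_mul]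
    by_cases hij : i = j
    · subst hij
      rw [Matrix.charmatrix_apply_eq, Matrix.diagonal_apply_eq, ← map_add]
      congr 1
      simp
      ring
    · rw [Matrix.charmatrix_apply_ne _ _ _ hij, Matrix.diagonal_apply_ne _ hij, zero_add]
      congr 1
      simp [hij]
      ring
  · simp only [map_add, map_mul, map_sum, map_prod, map_pow, Finset.mul_sum]
    congr 1
    refine Finset.sum_congr rfl fun k _ => ?_
    ring
end
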